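/- arXiv:math/0604262 — 3 statements merged into one kernel-verified Lean document; each statement's English description precedes it below -/
import Mathlib

section
/- Suppose h satisfies E(h^2 ∧ u) = O((log log u)^{d−1}) as u → ∞. Then for every I ⊆ {1,…,d} with I ≠ ∅ and I ≠ {1,…,d}, and every a > 0, Σ_{l=0}^∞ Σ_{n=3}^∞ 2^{l + #I^c n} P_{I^c}( E_I(h^2 ∧ 2^{an}) ≥ 2^{2l + #I^c n} (log n)^d ) < ∞. As a consequence, for every integer k ≥ 0, Σ_n 2^{#I^c n} (log n)^{−k} P_{I^c}( E_I(h^2 ∧ 2^{2nd}) ≥ 2^{#I^c n} (log n)^{d−k} ) < ∞. -/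
open MeasureTheory ProbabilityTheory Filter Finset

noncomputable section

/-- `E_I g`: integration of `g` in the coordinates belonging to `I` (the result
depends only on the remaining coordinates). -/
def condExpI {S : Type*} [MeasurableSpace S] {d : ℕ} (μ : Measure S)
    (I : Finset (Fin d)) (g : (Fin d → S) → ℝ) (x : Fin d → S) : ℝ :=
  ∫ y, g (fun k => if k ∈ I then y k else x k) ∂(Measure.pi fun _ : Fin d => μ)

lemma merge_mp {S : Type*} [MeasurableSpace S] {d : ℕ} (μ : Measure S) [IsProbabilityMeasure μ]
    (I : Finset (Fin d)) :
    MeasurePreserving (fun p : (Fin d → S) × (Fin d → S) => fun k => if k ∈ I then p.2 k else p.1 k)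
      ((Measure.pi fun _ : Fin d => μ).prod (Measure.pi fun _ : Fin d => μ))
      (Measure.pi fun _ : Fin d => μ) := by
  have hm : Measurable (fun p : (Fin d → S) × (Fin d → S) =>
      fun k => if k ∈ I then p.2 k else p.1 k) := by
    refine measurable_pi_lambda _ fun k => ?_
    by_cases hk : k ∈ I
    · simp only [hk, if_true]; fun_prop
    · simp only [hk, if_false]; fun_prop
  refine ⟨hm, ?_⟩
  symm
  refine Measure.pi_eq fun s hs => ?_
  rw [Measure.map_apply hm (MeasurableSet.univ_pi hs)]
  have : (fun p : (Fin d → S) × (Fin d → S) => fun k => if k ∈ I then p.2 k else p.1 k) ⁻¹'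
      (Set.univ.pi s) = (Set.univ.pi fun k => if k ∈ I then Set.univ else s k) ×ˢ
        (Set.univ.pi fun k => if k ∈ I then s k else Set.univ) := by
    ext p
    simp only [Set.mem_preimage, Set.mem_pi, Set.mem_univ, forall_true_left, Set.mem_prod]
    rw [← forall_and]
    refine forall_congr' fun k => ?_
    by_cases hk : k ∈ I <;> simp [hk]
  rw [this, Measure.prod_prod, Measure.pi_pi, Measure.pi_pi, ← Finset.prod_mul_distrib]
  refine Finset.prod_congr rfl fun k _ => ?_
  by_cases hk : k ∈ I <;> simp [hk]

section
variable {S : Type*} [MeasurableSpace S] {d : ℕ} (μ : Measure S) [IsProbabilityMeasure μ]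
    (I : Finset (Fin d)) (h : (Fin d → S) → ℝ)

lemma meas_merge {S : Type*} [MeasurableSpace S] {d : ℕ} (μ : Measure S) [IsProbabilityMeasure μ]
    (I : Finset (Fin d)) (x : Fin d → S) :
    Measurable (fun y : Fin d → S => fun k => if k ∈ I then y k else x k) :=
  (merge_mp μ I).measurable.comp (measurable_const.prodMk measurable_id)

lemma int_min (f : (Fin d → S) → ℝ) (hf : Measurable f) {u : ℝ} (hu : 0 ≤ u) :
    Integrable (fun y => min ((f y) ^ 2) u) (Measure.pi fun _ : Fin d => μ) := by
  refine Integrable.of_bound (C := u) ?_ (ae_of_all _ fun y => ?_)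
  · exact ((hf.pow_const 2).min measurable_const).aestronglyMeasurable
  · rw [Real.norm_of_nonneg (le_min (sq_nonneg _) hu)]
    exact min_le_right _ _

lemma Y_mono (hmh : Measurable h) {u v : ℝ} (hu : 0 ≤ u) (huv : u ≤ v) (x : Fin d → S) :
    condExpI μ I (fun y => min ((h y) ^ 2) u) x ≤ condExpI μ I (fun y => min ((h y) ^ 2) v) x := by
  unfold condExpI
  have hm := hmh.comp (meas_merge μ I x)
  refine integral_mono (int_min μ _ hm hu) (int_min μ _ hm (hu.trans huv)) fun y => ?_
  exact min_le_min_left _ huv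

lemma Y_nonneg {u : ℝ} (hu : 0 ≤ u) (x : Fin d → S) :
    0 ≤ condExpI μ I (fun y => min ((h y) ^ 2) u) x :=
  integral_nonneg fun _ => le_min (sq_nonneg _) hu

lemma Y_eq (hmh : Measurable h) {u : ℝ} (hu : 0 ≤ u) (x : Fin d → S) :
    ENNReal.ofReal (condExpI μ I (fun y => min ((h y) ^ 2) u) x) =
      ∫⁻ y, ENNReal.ofReal (min ((h (fun k => if k ∈ I then y k else x k)) ^ 2) u)
        ∂(Measure.pi fun _ : Fin d => μ) := by
  unfold condExpI
  exact ofReal_integral_eq_lintegral_ofReal (int_min μ _ (hmh.comp (meas_merge μ I x)) hu)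
    (ae_of_all _ fun _ => le_min (sq_nonneg _) hu)

lemma Y_meas (hmh : Measurable h) {u : ℝ} (hu : 0 ≤ u) :
    Measurable fun x => ENNReal.ofReal (condExpI μ I (fun y => min ((h y) ^ 2) u) x) := by
  simp_rw [Y_eq μ I h hmh hu]
  refine Measurable.lintegral_prod_right' (f := fun p : (Fin d → S) × (Fin d → S) =>
    ENNReal.ofReal (min ((h (fun k => if k ∈ I then p.2 k else p.1 k)) ^ 2) u)) ?_
  exact (((hmh.comp (merge_mp μ I).measurable).pow_const 2).min measurable_const).ennreal_ofReal

lemma Y_lint (hmh : Measurable h) {u : ℝ} (hu : 0 ≤ u) :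
    ∫⁻ x, ENNReal.ofReal (condExpI μ I (fun y => min ((h y) ^ 2) u) x)
      ∂(Measure.pi fun _ : Fin d => μ) =
    ENNReal.ofReal (∫ x, min ((h x) ^ 2) u ∂(Measure.pi fun _ : Fin d => μ)) := by
  simp_rw [Y_eq μ I h hmh hu]
  have hg : Measurable fun x => ENNReal.ofReal (min ((h x) ^ 2) u) :=
    ((hmh.pow_const 2).min measurable_const).ennreal_ofReal
  rw [ofReal_integral_eq_lintegral_ofReal (int_min μ _ hmh hu)
    (ae_of_all _ fun _ => le_min (sq_nonneg _) hu), ← (merge_mp μ I).lintegral_comp hg]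
  exact (lintegral_prod _ (hg.comp (merge_mp μ I).measurable).aemeasurable).symm

end

lemma geom_bd (m : ℕ) (hm : 1 ≤ m) (N : ℕ) :
    ∑ n ∈ range (N + 1), (2 : ENNReal) ^ (m * (n + 3)) ≤ 2 * 2 ^ (m * (N + 3)) := by
  induction N with
  | zero => simp [two_mul]
  | succ N ih =>
    rw [Finset.sum_range_succ, two_mul]
    gcongr
    refine ih.trans ?_
    rw [← pow_succ']
    exact pow_le_pow_right₀ one_le_two (by nlinarith)

lemma pt_bd (m : ℕ) (hm : 1 ≤ m) (g : ENNReal) :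
    ∑' n : ℕ, (if (2 : ENNReal) ^ (m * (n + 3)) ≤ g then (2 : ENNReal) ^ (m * (n + 3)) else 0)
      ≤ 2 * g := by
  refine ENNReal.tsum_le_of_sum_range_le fun N => ?_
  induction N with
  | zero => simp
  | succ N ih =>
    by_cases hN : (2 : ENNReal) ^ (m * (N + 3)) ≤ g
    · calc _ ≤ ∑ n ∈ range (N + 1), (2 : ENNReal) ^ (m * (n + 3)) := by
            refine Finset.sum_le_sum fun n _ => ?_
            split_ifs <;> simp
        _ ≤ 2 * 2 ^ (m * (N + 3)) := geom_bd m hm N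
        _ ≤ 2 * g := by gcongr
    · rw [Finset.sum_range_succ, if_neg hN, add_zero]; exact ih

lemma layer {X : Type*} [MeasurableSpace X] (P : Measure X) (m : ℕ) (hm : 1 ≤ m)
    (G : X → ENNReal) (hG : Measurable G) :
    ∑' n : ℕ, (2 : ENNReal) ^ (m * (n + 3)) * P {x | (2 : ENNReal) ^ (m * (n + 3)) ≤ G x}
      ≤ 2 * ∫⁻ x, G x ∂P := by
  rw [← lintegral_const_mul _ hG]
  have : ∀ n : ℕ, (2 : ENNReal) ^ (m * (n + 3)) * P {x | (2 : ENNReal) ^ (m * (n + 3)) ≤ G x}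
      = ∫⁻ x, (if (2 : ENNReal) ^ (m * (n + 3)) ≤ G x then (2 : ENNReal) ^ (m * (n + 3)) else 0)
        ∂P := by
    intro n
    rw [← lintegral_indicator_const (measurableSet_le measurable_const hG)]
    refine lintegral_congr fun x => ?_
    simp [Set.indicator_apply]
  simp_rw [this]
  rw [← lintegral_tsum]
  · exact lintegral_mono fun x => pt_bd m hm (G x)
  · intro n
    exact (Measurable.ite (measurableSet_le measurable_const hG) measurable_const
      measurable_const).aemeasurable

/-- truncated second moment along `u = 2^(a exp(2^(j+1)))`. -/
lemma moment_bd {S : Type*} [MeasurableSpace S] {d : ℕ} (hd : 1 ≤ d)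
    (μ : Measure S) [IsProbabilityMeasure μ]
    (h : (Fin d → S) → ℝ)
    (hO : ∃ K u₀ : ℝ, ∀ u : ℝ, u₀ ≤ u →
      ∫ x, min ((h x) ^ 2) u ∂(Measure.pi fun _ : Fin d => μ)
        ≤ K * (Real.log (Real.log u)) ^ ((d : ℝ) - 1)) (a : ℝ) (ha : 0 < a) :
    ∃ C : ℝ, 0 ≤ C ∧ ∀ j : ℕ,
      ∫ x, min ((h x) ^ 2) ((2 : ℝ) ^ (a * Real.exp (2 ^ (j + 1))))
        ∂(Measure.pi fun _ : Fin d => μ) ≤ C * (2 ^ j) ^ (d - 1) := by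
  obtain ⟨K, u₀, hK⟩ := hO
  have hl2 : 0 < a * Real.log 2 := mul_pos ha (Real.log_pos one_lt_two)
  set b := Real.log (a * Real.log 2) with hb
  have hll : ∀ j : ℕ, Real.log (Real.log ((2 : ℝ) ^ (a * Real.exp (2 ^ (j + 1)))))
      = b + 2 ^ (j + 1) := by
    intro j
    rw [Real.log_rpow two_pos, show a * Real.exp (2 ^ (j + 1)) * Real.log 2
      = (a * Real.log 2) * Real.exp (2 ^ (j + 1)) by ring,
      Real.log_mul hl2.ne' (Real.exp_pos _).ne', Real.log_exp]
  have ht : Tendsto (fun j : ℕ => (2 : ℝ) ^ (j + 1)) atTop atTop :=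
    (tendsto_pow_atTop_atTop_of_one_lt one_lt_two).comp (tendsto_add_atTop_nat 1)
  have hu : Tendsto (fun j : ℕ => (2 : ℝ) ^ (a * Real.exp (2 ^ (j + 1)))) atTop atTop :=
    (tendsto_rpow_atTop_of_base_gt_one 2 one_lt_two).comp
      ((Real.tendsto_exp_atTop.comp ht).const_mul_atTop ha)
  have hO' : (fun j : ℕ => ∫ x, min ((h x) ^ 2) ((2 : ℝ) ^ (a * Real.exp (2 ^ (j + 1))))
        ∂(Measure.pi fun _ : Fin d => μ)) =O[atTop] fun j : ℕ => ((2 : ℝ) ^ j) ^ (d - 1) := by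
    refine Asymptotics.IsBigO.of_bound (|K| * (|b| + 2) ^ (d - 1)) ?_
    filter_upwards [hu.eventually_ge_atTop u₀, ht.eventually_ge_atTop (-b)] with j h1 h2
    have h3 := hK _ h1
    rw [hll, show (d : ℝ) - 1 = ((d - 1 : ℕ) : ℝ) by push_cast [hd]; ring,
      Real.rpow_natCast] at h3
    rw [Real.norm_of_nonneg (integral_nonneg fun _ => le_min (sq_nonneg _) (by positivity)),
      Real.norm_of_nonneg (by positivity)]
    have h1j : (1 : ℝ) ≤ 2 ^ j := one_le_pow₀ one_le_two
    have h4 : b + 2 ^ (j + 1) ≤ (|b| + 2) * 2 ^ j := by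
      rw [pow_succ]
      nlinarith [le_abs_self b, abs_nonneg b]
    have h5 : 0 ≤ b + 2 ^ (j + 1) := by linarith
    calc _ ≤ _ := h3
      _ ≤ |K| * (b + 2 ^ (j + 1)) ^ (d - 1) := by gcongr; exact le_abs_self K
      _ ≤ |K| * ((|b| + 2) * 2 ^ j) ^ (d - 1) := by gcongr
      _ = _ := by rw [mul_pow]; ring
  obtain ⟨C, hC⟩ := (Asymptotics.isBigO_nat_atTop_iff (fun j hj => absurd hj (by positivity))).1 hO'
  refine ⟨|C|, abs_nonneg _, fun j => (le_abs_self _).trans ?_⟩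
  have := hC j
  rw [Real.norm_eq_abs, Real.norm_of_nonneg (by positivity)] at this
  exact this.trans (by gcongr; exact le_abs_self C)

lemma main_bd {S : Type*} [MeasurableSpace S] {d : ℕ} (hd : 1 ≤ d)
    (μ : Measure S) [IsProbabilityMeasure μ]
    (h : (Fin d → S) → ℝ) (hmh : Measurable h)
    (hO : ∃ K u₀ : ℝ, ∀ u : ℝ, u₀ ≤ u →
      ∫ x, min ((h x) ^ 2) u ∂(Measure.pi fun _ : Fin d => μ)
        ≤ K * (Real.log (Real.log u)) ^ ((d : ℝ) - 1)) (a : ℝ) (ha : 0 < a)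
    (I : Finset (Fin d)) (m : ℕ) (hm : 1 ≤ m) (k : ℕ) :
    ∃ C : ℝ, 0 ≤ C ∧ ∀ c : ℝ, 0 < c →
      ∑' n : ℕ, ENNReal.ofReal ((2 : ℝ) ^ (m * (n + 3)) * (Real.log (n + 3)) ^ (-(k : ℝ))) *
          (Measure.pi fun _ : Fin d => μ)
            {x | c * (2 : ℝ) ^ (m * (n + 3)) * (Real.log (n + 3)) ^ ((d : ℝ) - k)
              ≤ condExpI μ I
                  (fun y => min ((h y) ^ 2) ((2 : ℝ) ^ (a * ((n : ℝ) + 3)))) x}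
        ≤ ENNReal.ofReal (C / c) := by
  obtain ⟨C, hC0, hC⟩ := moment_bd hd μ h hO a ha
  refine ⟨2 ^ (k + 2) * C, by positivity, fun c hc => ?_⟩
  set P := Measure.pi fun _ : Fin d => μ with hP
  set u : ℕ → ℝ := fun j => (2 : ℝ) ^ (a * Real.exp (2 ^ (j + 1))) with hu
  have hu0 : ∀ j, 0 ≤ u j := fun j => by positivity
  set r : ℕ → ℝ := fun j => (2 ^ (j + 1)) ^ k / ((2 ^ j) ^ d * c) with hr
  have hr0 : ∀ j, 0 ≤ r j := fun j => by positivity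
  set G : ℕ → (Fin d → S) → ENNReal := fun j x =>
    ENNReal.ofReal (r j) * ENNReal.ofReal (condExpI μ I (fun y => min ((h y) ^ 2) (u j)) x) with hG
  have hGm : ∀ j, Measurable (G j) := fun j => (Y_meas μ I h hmh (hu0 j)).const_mul _
  have key : ∀ n : ℕ, ENNReal.ofReal ((2 : ℝ) ^ (m * (n + 3)) *
        (Real.log (n + 3)) ^ (-(k : ℝ))) * P
            {x | c * (2 : ℝ) ^ (m * (n + 3)) * (Real.log (n + 3)) ^ ((d : ℝ) - k)
              ≤ condExpI μ I
                  (fun y => min ((h y) ^ 2) ((2 : ℝ) ^ (a * ((n : ℝ) + 3)))) x}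
      ≤ ∑' j : ℕ, ENNReal.ofReal (((2 ^ j) ^ k)⁻¹) *
        ((2 : ENNReal) ^ (m * (n + 3)) * P {x | (2 : ENNReal) ^ (m * (n + 3)) ≤ G j x}) := by
    intro n
    have hn3 : (3 : ℝ) ≤ (n : ℝ) + 3 := by have := n.cast_nonneg (α := ℝ); linarith
    have hn0 : (0 : ℝ) < (n : ℝ) + 3 := by linarith
    have hL1 : 1 ≤ Real.log ((n : ℝ) + 3) := by
      rw [Real.le_log_iff_exp_le hn0]
      linarith [Real.exp_one_lt_d9]
    obtain ⟨j, hj1, hj2⟩ := exists_nat_pow_near hL1 one_lt_two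
    set L := Real.log ((n : ℝ) + 3) with hL
    have hL0 : 0 < L := by linarith
    refine le_trans ?_ (ENNReal.le_tsum j)
    rw [Real.rpow_neg hL0.le, Real.rpow_natCast, mul_comm ((2 : ℝ) ^ _),
      ENNReal.ofReal_mul (by positivity), ENNReal.ofReal_pow two_pos.le, ENNReal.ofReal_ofNat,
      mul_assoc]
    gcongr with x
    intro hx
    have hexp : (n : ℝ) + 3 ≤ Real.exp (2 ^ (j + 1)) := by
      rw [← Real.log_le_iff_le_exp hn0]; exact hj2.le
    have hY := Y_mono μ I h hmh (u := (2 : ℝ) ^ (a * ((n : ℝ) + 3))) (v := u j) (by positivity)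
      (Real.rpow_le_rpow_of_exponent_le one_le_two (by gcongr)) x
    have hx2 := hx.trans hY
    have hY0 := Y_nonneg μ I h (hu0 j) x
    set Y := condExpI μ I (fun y => min ((h y) ^ 2) (u j)) x with hYd
    show (2 : ENNReal) ^ (m * (n + 3)) ≤ ENNReal.ofReal (r j) * ENNReal.ofReal Y
    rw [← ENNReal.ofReal_mul (hr0 j), ← ENNReal.ofReal_ofNat 2, ← ENNReal.ofReal_pow two_pos.le]
    refine ENNReal.ofReal_le_ofReal ?_
    rw [Real.rpow_sub hL0, Real.rpow_natCast, Real.rpow_natCast] at hx2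
    have h1 : (2 : ℝ) ^ (m * (n + 3)) ≤ L ^ k / (L ^ d * c) * Y := by
      rw [div_mul_eq_mul_div, le_div_iff₀ (by positivity)]
      have := mul_le_mul_of_nonneg_left hx2 (pow_pos hL0 k).le
      refine le_trans (le_of_eq ?_) this
      field_simp
    refine h1.trans ?_
    refine mul_le_mul_of_nonneg_right ?_ hY0
    simp only [hr]
    gcongr
  calc _ ≤ _ := ENNReal.tsum_le_tsum key
    _ = ∑' j : ℕ, ENNReal.ofReal (((2 ^ j) ^ k)⁻¹) * ∑' n : ℕ,
        ((2 : ENNReal) ^ (m * (n + 3)) * P {x | (2 : ENNReal) ^ (m * (n + 3)) ≤ G j x}) := by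
          rw [ENNReal.tsum_comm]; simp_rw [ENNReal.tsum_mul_left]
    _ ≤ ∑' j : ℕ, ENNReal.ofReal ((2 ^ (k + 1) * C / c) * (1 / 2) ^ j) := by
          refine ENNReal.tsum_le_tsum fun j => ?_
          calc _ ≤ ENNReal.ofReal (((2 ^ j) ^ k)⁻¹) * (2 * ∫⁻ x, G j x ∂P) := by
                gcongr; exact layer P m hm _ (hGm j)
            _ ≤ ENNReal.ofReal (((2 ^ j) ^ k)⁻¹) * (ENNReal.ofReal 2 * (ENNReal.ofReal (r j) *
                  ENNReal.ofReal (C * (2 ^ j) ^ (d - 1)))) := by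
                rw [ENNReal.ofReal_ofNat]
                gcongr
                rw [hG, lintegral_const_mul _ (Y_meas μ I h hmh (hu0 j)), Y_lint μ I h hmh (hu0 j)]
                gcongr
                exact hC j
            _ = _ := by
                rw [← ENNReal.ofReal_mul (hr0 j), ← ENNReal.ofReal_mul two_pos.le,
                  ← ENNReal.ofReal_mul (by positivity)]
                congr 1
                obtain ⟨e, rfl⟩ : ∃ e, d = e + 1 := ⟨d - 1, by omega⟩
                simp only [hr, Nat.add_sub_cancel, one_div, inv_pow]
                have : ((2 : ℝ) ^ (j + 1)) ^ k = (2 ^ j) ^ k * 2 ^ k := by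
                  rw [pow_succ, mul_pow]
                rw [this]
                field_simp
                try ring
    _ = _ := by
          rw [← ENNReal.ofReal_tsum_of_nonneg (fun j => by positivity)
            (summable_geometric_two.mul_left _), tsum_mul_left, tsum_geometric_two]
          congr 1; ring

/-- Lemma 4: summability consequences of the integrability condition
`E(h² ∧ u) = O((log log u)^{d−1})`. -/
theorem summability_from_integrability_condition
    {S : Type*} [MeasurableSpace S] {d : ℕ} (hd : 1 ≤ d)
    (μ : Measure S) [IsProbabilityMeasure μ]
    (h : (Fin d → S) → ℝ) (hmh : Measurable h)
    (hO : ∃ K u₀ : ℝ, ∀ u : ℝ, u₀ ≤ u →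
      ∫ x, min ((h x) ^ 2) u ∂(Measure.pi fun _ : Fin d => μ)
        ≤ K * (Real.log (Real.log u)) ^ ((d : ℝ) - 1)) :
    ∀ I : Finset (Fin d), I ≠ ∅ → I ≠ Finset.univ →
      -- the double series from Lemma 4
      ((∀ a : ℝ, 0 < a →
        (∑' (l : ℕ) (n : ℕ), (2 : ENNReal) ^ (l + Iᶜ.card * (n + 3)) *
          (Measure.pi fun _ : Fin d => μ)
            {x | (2 : ℝ) ^ (2 * l + Iᶜ.card * (n + 3)) * (Real.log (n + 3)) ^ d
              ≤ condExpI μ I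
                  (fun y => min ((h y) ^ 2) ((2 : ℝ) ^ (a * ((n : ℝ) + 3)))) x})
          < ⊤) ∧
      -- and, as a consequence, the single series
       (∀ k : ℕ,
        (∑' n : ℕ, ENNReal.ofReal
            ((2 : ℝ) ^ (Iᶜ.card * (n + 3)) * (Real.log (n + 3)) ^ (-(k : ℝ))) *
          (Measure.pi fun _ : Fin d => μ)
            {x | (2 : ℝ) ^ (Iᶜ.card * (n + 3)) * (Real.log (n + 3)) ^ ((d : ℝ) - k)
              ≤ condExpI μ I
                  (fun y => min ((h y) ^ 2) ((2 : ℝ) ^ (2 * (n + 3) * d))) x})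
          < ⊤)) := by
  intro I hI hI'
  have hm : 1 ≤ Iᶜ.card := by
    rw [Nat.one_le_iff_ne_zero, Finset.card_ne_zero, Finset.nonempty_iff_ne_empty]
    intro h0
    exact hI' (by simpa using h0)
  refine ⟨fun a ha => ?_, fun k => ?_⟩
  · obtain ⟨C, hC0, hC⟩ := main_bd hd μ h hmh hO a ha I _ hm 0
    have : ∀ l : ℕ, (∑' (n : ℕ), (2 : ENNReal) ^ (l + Iᶜ.card * (n + 3)) *
          (Measure.pi fun _ : Fin d => μ)
            {x | (2 : ℝ) ^ (2 * l + Iᶜ.card * (n + 3)) * (Real.log (n + 3)) ^ d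
              ≤ condExpI μ I
                  (fun y => min ((h y) ^ 2) ((2 : ℝ) ^ (a * ((n : ℝ) + 3)))) x})
          ≤ ENNReal.ofReal (C * (1 / 2) ^ l) := by
      intro l
      have h1 := hC (2 ^ (2 * l)) (by positivity)
      simp only [Nat.cast_zero, neg_zero, Real.rpow_zero, mul_one, sub_zero,
        Real.rpow_natCast, ← pow_add, ENNReal.ofReal_pow two_pos.le, ENNReal.ofReal_ofNat] at h1
      simp_rw [pow_add (2 : ENNReal) l, mul_assoc]
      rw [ENNReal.tsum_mul_left]
      calc _ ≤ 2 ^ l * ENNReal.ofReal (C / 2 ^ (2 * l)) := by gcongr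
        _ = _ := by
          rw [← ENNReal.ofReal_ofNat 2, ← ENNReal.ofReal_pow two_pos.le,
            ← ENNReal.ofReal_mul (by positivity)]
          congr 1
          rw [two_mul, pow_add, one_div, inv_pow]
          field_simp
    refine (ENNReal.tsum_le_tsum this).trans_lt ?_
    rw [← ENNReal.ofReal_tsum_of_nonneg (fun j => by positivity)
            (summable_geometric_two.mul_left _)]
    exact ENNReal.ofReal_lt_top
  · obtain ⟨C, hC0, hC⟩ := main_bd hd μ h hmh hO (2 * d) (by positivity) I _ hm k
    refine lt_of_le_of_lt ?_ (ENNReal.ofReal_lt_top (r := C / 1))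
    refine le_trans (le_of_eq ?_) (hC 1 one_pos)
    refine tsum_congr fun n => ?_
    have he : (2 : ℝ) ^ (2 * (n + 3) * d) = (2 : ℝ) ^ (2 * (d : ℝ) * ((n : ℝ) + 3)) := by
      rw [← Real.rpow_natCast]
      congr 1
      push_cast
      ring
    simp only [one_mul, he]
end
end

section
/- If a real random variable h satisfies E(h^2 ∧ u) = O((log log u)^β) as u → ∞ for some β ≥ 0, then E[|h| 1_{|h| ≥ s}] = O((log log s)^β / s) as s → ∞. -/
open MeasureTheory ProbabilityTheory

/-- Tail bound from the truncated second moment. -/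
theorem aux_tail {Ω : Type*} [MeasurableSpace Ω] {P : Measure Ω} [IsProbabilityMeasure P]
    (h : Ω → ℝ) (hm : AEMeasurable h P) (t : ℝ) (ht : 0 < t) (B : ℝ)
    (hB : ∫ ω, min ((h ω) ^ 2) (t ^ 2) ∂P ≤ B) :
    P {ω | t ≤ |h ω|} ≤ ENNReal.ofReal (B / t ^ 2) := by
  have hi : Integrable (fun ω => min ((h ω) ^ 2) (t ^ 2)) P := by
    refine Integrable.of_bound ?_ (t ^ 2) ?_
    · exact ((hm.pow_const 2).min aemeasurable_const).aestronglyMeasurable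
    · refine Filter.Eventually.of_forall fun ω => ?_
      rw [Real.norm_of_nonneg (by positivity)]
      exact min_le_right _ _
  have h1 := mul_meas_ge_le_integral_of_nonneg (μ := P)
    (Filter.Eventually.of_forall fun ω => by
      show (0 : ℝ) ≤ min ((h ω) ^ 2) (t ^ 2)
      positivity) hi (t ^ 2)
  have hs : {ω | t ^ 2 ≤ min ((h ω) ^ 2) (t ^ 2)} = {ω | t ≤ |h ω|} := by
    ext ω
    simp only [Set.mem_ofPred_eq, le_min_iff, le_refl, and_true]
    rw [← sq_abs (h ω)]
    exact pow_le_pow_iff_left₀ ht.le (abs_nonneg _) two_ne_zero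
  rw [hs] at h1
  rw [← ofReal_measureReal]
  apply ENNReal.ofReal_le_ofReal
  rw [le_div_iff₀ (by positivity)]
  linarith

/-- Growth of the iterated logarithm along the dyadic sequence. -/
theorem aux_loglog (s : ℝ) (hs : Real.exp (Real.exp 1) ≤ s) (k : ℕ) :
    0 ≤ Real.log (Real.log ((2 ^ k * s) ^ 2)) ∧
    Real.log (Real.log ((2 ^ k * s) ^ 2)) ≤ 2 * ((k : ℝ) + 1) * Real.log (Real.log s) := by
  have hs0 : 0 < s := (Real.exp_pos _).trans_le hs
  have h1 : Real.exp 1 ≤ Real.log s := (Real.le_log_iff_exp_le hs0).2 hs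
  have hl0 : 0 < Real.log s := (Real.exp_pos _).trans_le h1
  have h2 : 1 ≤ Real.log (Real.log s) := (Real.le_log_iff_exp_le hl0).2 h1
  have he : 2 ≤ Real.exp 1 := by have := Real.add_one_le_exp 1; linarith
  have hl2 : Real.log 2 ≤ 1 := by have := Real.log_two_lt_d9; linarith
  have hl2' : 0 ≤ Real.log 2 := by have := Real.log_two_gt_d9; linarith
  have hk : (0 : ℝ) ≤ k := k.cast_nonneg
  have e : Real.log ((2 ^ k * s) ^ 2) = 2 * (k * Real.log 2 + Real.log s) := by
    rw [Real.log_pow, Real.log_mul (by positivity) hs0.ne', Real.log_pow]; norm_num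
  have hkl : 0 ≤ k * Real.log 2 := by positivity
  rw [e]
  refine ⟨Real.log_nonneg (by linarith), ?_⟩
  have h3 : 2 * (k * Real.log 2 + Real.log s) ≤ (2 * ((k : ℝ) + 1)) * Real.log s := by
    nlinarith
  have h4 := Real.log_le_log (by linarith) h3
  rw [Real.log_mul (by positivity) hl0.ne'] at h4
  have h5 := Real.log_le_sub_one_of_pos (show 0 < 2 * ((k : ℝ) + 1) by positivity)
  nlinarith

theorem aux_summable (β : ℝ) :
    Summable fun k : ℕ => (2 * ((k : ℝ) + 1)) ^ β * (1 / 2 : ℝ) ^ k := by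
  obtain ⟨n, hn⟩ := exists_nat_ge β
  have h0 := summable_pow_mul_geometric_of_norm_lt_one (R := ℝ) n (r := 1 / 2) (by norm_num)
  have h1 := ((summable_nat_add_iff 1).2 h0).mul_left (2 ^ n * 2)
  refine Summable.of_nonneg_of_le (fun k => by positivity) (fun k => ?_) h1
  have h2 : (2 * ((k : ℝ) + 1)) ^ β ≤ (2 * ((k : ℝ) + 1)) ^ (n : ℝ) :=
    Real.rpow_le_rpow_of_exponent_le (by have : (0 : ℝ) ≤ k := k.cast_nonneg
                                         linarith) hn
  rw [Real.rpow_natCast, mul_pow] at h2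
  calc _ ≤ (2 ^ n * ((k : ℝ) + 1) ^ n) * (1 / 2 : ℝ) ^ k := by gcongr
    _ = _ := by push_cast; rw [pow_succ (1 / 2 : ℝ) k]; ring

/-- Lemma 5: if `E(h² ∧ u) = O((log log u)^β)` then
`E[|h| 1_{|h| ≥ s}] = O((log log s)^β / s)`. -/
theorem truncated_first_moment_bound
    {Ω : Type*} [MeasurableSpace Ω] {P : Measure Ω} [IsProbabilityMeasure P]
    (h : Ω → ℝ) (hm : AEMeasurable h P) (β : ℝ) (hβ : 0 ≤ β)
    (hO : ∃ K u₀ : ℝ, ∀ u : ℝ, u₀ ≤ u →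
      ∫ ω, min ((h ω) ^ 2) u ∂P ≤ K * (Real.log (Real.log u)) ^ β) :
    ∃ K' s₀ : ℝ, ∀ s : ℝ, s₀ ≤ s →
      ∫⁻ ω in {ω | s ≤ |h ω|}, ENNReal.ofReal |h ω| ∂P
        ≤ ENNReal.ofReal (K' * (Real.log (Real.log s)) ^ β / s) := by
  obtain ⟨K, u₀, hK⟩ := hO
  set S : ℝ := ∑' k : ℕ, (2 * ((k : ℝ) + 1)) ^ β * (1 / 2 : ℝ) ^ k with hS
  refine ⟨2 * |K| * S, max u₀ (Real.exp (Real.exp 1)), fun s hs => ?_⟩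
  have hsu : u₀ ≤ s := (le_max_left _ _).trans hs
  have hse : Real.exp (Real.exp 1) ≤ s := (le_max_right _ _).trans hs
  have hs1 : 1 ≤ s := (Real.one_le_exp (Real.exp_pos 1).le).trans hse
  have hs0 : 0 < s := by linarith
  have hL : 0 ≤ Real.log (Real.log s) := by
    have := aux_loglog s hse 0
    norm_num at this
    linarith [this.1, this.2]
  set L := Real.log (Real.log s) with hLdef
  have hnull : ∀ t : ℝ, NullMeasurableSet {ω | t ≤ |h ω|} P := fun t =>
    nullMeasurableSet_le aemeasurable_const (measurable_abs.comp_aemeasurable hm)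
  have key : ∀ k : ℕ, ENNReal.ofReal (2 ^ (k + 1) * s) * P {ω | 2 ^ k * s ≤ |h ω|} ≤
      ENNReal.ofReal (2 * |K| * L ^ β / s * ((2 * ((k : ℝ) + 1)) ^ β * (1 / 2 : ℝ) ^ k)) := by
    intro k
    obtain ⟨a1, a2⟩ := aux_loglog s hse k
    have hp : (1 : ℝ) ≤ 2 ^ k := one_le_pow₀ (by norm_num)
    have ht1 : s ≤ (2 ^ k * s) ^ 2 := by
      have : s ≤ 2 ^ k * s := by nlinarith
      nlinarith
    have hB : ∫ ω, min ((h ω) ^ 2) ((2 ^ k * s) ^ 2) ∂P ≤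
        |K| * ((2 * ((k : ℝ) + 1)) ^ β * L ^ β) := by
      refine (hK _ (hsu.trans ht1)).trans ?_
      rw [← Real.mul_rpow (by positivity) hL]
      exact mul_le_mul (le_abs_self K) (Real.rpow_le_rpow a1 a2 hβ)
        (Real.rpow_nonneg a1 _) (abs_nonneg _)
    have := aux_tail h hm (2 ^ k * s) (by positivity) _ hB
    refine (mul_le_mul_right this _).trans ?_
    rw [← ENNReal.ofReal_mul (by positivity)]
    apply ENNReal.ofReal_le_ofReal
    apply le_of_eq
    rw [one_div, inv_pow]
    field_simp
    ring
  calc ∫⁻ ω in {ω | s ≤ |h ω|}, ENNReal.ofReal |h ω| ∂P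
      = ∫⁻ ω, {ω | s ≤ |h ω|}.indicator (fun ω => ENNReal.ofReal |h ω|) ω ∂P :=
        (lintegral_indicator₀ (hnull s) _).symm
    _ ≤ ∫⁻ ω, ∑' k : ℕ, {ω | 2 ^ k * s ≤ |h ω|}.indicator
          (fun _ => ENNReal.ofReal (2 ^ (k + 1) * s)) ω ∂P := by
        refine lintegral_mono fun ω => ?_
        by_cases hω : s ≤ |h ω|
        · rw [Set.indicator_of_mem (by exact hω)]
          obtain ⟨k, hk1, hk2⟩ := exists_nat_pow_near (x := |h ω| / s) (y := 2)
            ((one_le_div hs0).2 hω) (by norm_num)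
          rw [le_div_iff₀ hs0] at hk1
          rw [div_lt_iff₀ hs0] at hk2
          refine le_trans ?_ (ENNReal.le_tsum k)
          rw [Set.indicator_of_mem (by exact hk1)]
          exact ENNReal.ofReal_le_ofReal hk2.le
        · rw [Set.indicator_of_notMem (by exact hω)]
          exact zero_le
    _ = ∑' k : ℕ, ENNReal.ofReal (2 ^ (k + 1) * s) * P {ω | 2 ^ k * s ≤ |h ω|} := by
        rw [lintegral_tsum (fun k => (aemeasurable_const.indicator₀ (hnull _)))]
        congr 1
        ext k
        rw [lintegral_indicator_const₀ (hnull _)]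
    _ ≤ ∑' k : ℕ, ENNReal.ofReal
          (2 * |K| * L ^ β / s * ((2 * ((k : ℝ) + 1)) ^ β * (1 / 2 : ℝ) ^ k)) :=
        ENNReal.tsum_le_tsum key
    _ = ENNReal.ofReal (2 * |K| * S * L ^ β / s) := by
        rw [← ENNReal.ofReal_tsum_of_nonneg (fun k => by positivity)
          ((aux_summable β).mul_left _), tsum_mul_left, ← hS]
        congr 1
        ring
end

section
/- If a real random variable h satisfies E(h^2 ∧ u) = O((log log u)^β) as u → ∞ for some β ≥ 0, then for every ε > 0, E[ h^2 / (LL |h|)^{β+ε} ] < ∞, where LL x = log log(max(x, e^e)). -/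
open MeasureTheory ProbabilityTheory

/-- Lemma 6: if `E(h² ∧ u) = O((log log u)^β)` then
`E[h² / (LL |h|)^{β+ε}] < ∞` for every `ε > 0`, where `LL x = log log (x ∨ e^e)`. -/
theorem finite_weighted_second_moment
    {Ω : Type*} [MeasurableSpace Ω] {P : Measure Ω} [IsProbabilityMeasure P]
    (h : Ω → ℝ) (hm : AEMeasurable h P) (β : ℝ) (hβ : 0 ≤ β)
    (hO : ∃ K u₀ : ℝ, ∀ u : ℝ, u₀ ≤ u →
      ∫ ω, min ((h ω) ^ 2) u ∂P ≤ K * (Real.log (Real.log u)) ^ β) :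
    ∀ ε : ℝ, 0 < ε →
      ∫⁻ ω, ENNReal.ofReal ((h ω) ^ 2 /
          (Real.log (Real.log (max (|h ω|) (Real.exp (Real.exp 1))))) ^ (β + ε)) ∂P
        < ⊤ := by
  intro ε hε
  obtain ⟨K, u₀, hK⟩ := hO
  let u : ℕ → ℝ := fun k => Real.exp (Real.exp (4 * 2 ^ k))
  have hu0 : ∀ k, 0 < u k := fun k => Real.exp_pos _
  let f : ℕ → Ω → ℝ := fun k ω => min ((h ω) ^ 2) (u k) / ((2 : ℝ) ^ k) ^ (β + ε)
  have hf0 : ∀ k ω, 0 ≤ f k ω := fun k ω =>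
    div_nonneg (le_min (sq_nonneg _) (hu0 k).le) (by positivity)
  have hmin_meas : ∀ k, AEMeasurable (fun ω => min ((h ω) ^ 2) (u k)) P := fun k =>
    (hm.pow_const 2).min aemeasurable_const
  have hfint : ∀ k, Integrable (f k) P := by
    intro k
    apply Integrable.div_const
    refine Integrable.of_bound (hmin_meas k).aestronglyMeasurable (u k) ?_
    filter_upwards with ω
    rw [Real.norm_of_nonneg (le_min (sq_nonneg _) (hu0 k).le)]
    exact min_le_right _ _
  -- pointwise bound
  have hpt : ∀ ω, ENNReal.ofReal ((h ω) ^ 2 /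
      (Real.log (Real.log (max (|h ω|) (Real.exp (Real.exp 1))))) ^ (β + ε))
      ≤ ∑' k, ENNReal.ofReal (f k ω) := by
    intro ω
    set M := max (|h ω|) (Real.exp (Real.exp 1)) with hM
    have hMe : Real.exp (Real.exp 1) ≤ M := le_max_right _ _
    have hMpos : 0 < M := (Real.exp_pos _).trans_le hMe
    have hlog : Real.exp 1 ≤ Real.log M := (Real.le_log_iff_exp_le hMpos).2 hMe
    have hlogpos : 0 < Real.log M := (Real.exp_pos _).trans_le hlog
    have hL : 1 ≤ Real.log (Real.log M) := (Real.le_log_iff_exp_le hlogpos).2 hlog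
    obtain ⟨k, hk1, hk2⟩ := exists_nat_pow_near hL (one_lt_two)
    refine le_trans ?_ (ENNReal.le_tsum k)
    apply ENNReal.ofReal_le_ofReal
    have hMle : M ≤ Real.exp (Real.exp (2 ^ (k + 1))) := by
      rw [← Real.log_le_iff_le_exp hMpos, ← Real.log_le_iff_le_exp hlogpos]
      exact hk2.le
    have hsq : (h ω) ^ 2 ≤ u k := by
      have h1 : |h ω| ≤ Real.exp (Real.exp (2 ^ (k + 1))) := (le_max_left _ _).trans hMle
      have h2 : (h ω) ^ 2 ≤ (Real.exp (Real.exp (2 ^ (k + 1)))) ^ 2 := by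
        rw [← sq_abs]
        exact pow_le_pow_left₀ (abs_nonneg _) h1 2
      refine h2.trans ?_
      rw [← Real.exp_nat_mul]
      apply Real.exp_le_exp.2
      have h3 : (4 : ℝ) * 2 ^ k = 2 ^ (k + 1) + 2 ^ (k + 1) := by ring
      rw [h3, Real.exp_add]
      apply mul_le_mul_of_nonneg_right _ (Real.exp_pos _).le
      have h4 : (1 : ℝ) ≤ 2 ^ (k + 1) := one_le_pow₀ (by norm_num)
      have := Real.add_one_le_exp ((2 : ℝ) ^ (k + 1))
      push_cast
      linarith
    simp only [f]
    rw [min_eq_left hsq]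
    gcongr
  -- summability
  have hsum : Summable (fun k => ∫ ω, f k ω ∂P) := by
    have hgeo : Summable (fun k : ℕ => |K| * (4 : ℝ) ^ β * ((2 : ℝ) ^ (-ε)) ^ k) := by
      apply Summable.mul_left
      exact summable_geometric_of_lt_one (by positivity)
        (Real.rpow_lt_one_of_one_lt_of_neg one_lt_two (by linarith))
    refine Summable.of_norm_bounded_eventually_nat hgeo ?_
    have htend : Filter.Tendsto u Filter.atTop Filter.atTop := by
      refine Real.tendsto_exp_atTop.comp (Real.tendsto_exp_atTop.comp ?_)
      exact (tendsto_pow_atTop_atTop_of_one_lt one_lt_two).const_mul_atTop (by norm_num)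
    filter_upwards [htend.eventually_ge_atTop u₀] with k hk
    rw [Real.norm_of_nonneg (integral_nonneg (hf0 k))]
    simp only [f]
    rw [integral_div, div_le_iff₀ (by positivity)]
    refine (hK _ hk).trans ?_
    have h1 : Real.log (Real.log (u k)) = 4 * 2 ^ k := by simp [u]
    have h2 : ((2 : ℝ) ^ (-ε)) ^ k = ((2 : ℝ) ^ k) ^ (-ε) := by
      rw [← Real.rpow_natCast, ← Real.rpow_natCast, ← Real.rpow_mul (by norm_num),
        ← Real.rpow_mul (by norm_num), mul_comm]
    rw [h1, h2, Real.mul_rpow (by norm_num) (by positivity)]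
    have h3 : ((2 : ℝ) ^ k) ^ (-ε) * ((2 : ℝ) ^ k) ^ (β + ε) = ((2 : ℝ) ^ k) ^ β := by
      rw [← Real.rpow_add (by positivity)]
      congr 1
      ring
    rw [mul_assoc, h3, mul_assoc]
    exact mul_le_mul_of_nonneg_right (le_abs_self K) (by positivity)
  calc _ ≤ ∫⁻ ω, ∑' k, ENNReal.ofReal (f k ω) ∂P := lintegral_mono hpt
    _ = ∑' k, ∫⁻ ω, ENNReal.ofReal (f k ω) ∂P :=
      lintegral_tsum fun k => (hfint k).aemeasurable.ennreal_ofReal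
    _ = ∑' k, ENNReal.ofReal (∫ ω, f k ω ∂P) := by
      congr 1
      ext k
      rw [ofReal_integral_eq_lintegral_ofReal (hfint k) (Filter.Eventually.of_forall (hf0 k))]
    _ = ENNReal.ofReal (∑' k, ∫ ω, f k ω ∂P) :=
      (ENNReal.ofReal_tsum_of_nonneg (fun k => integral_nonneg (hf0 k)) hsum).symm
    _ < ⊤ := ENNReal.ofReal_lt_top
end
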